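/- Consider the control system ẋ = (u_1, x_3 u_1, u_2) on ℝ³ and the quadratic stage cost ℓ(x,u) = xᵀQx + uᵀRu with positive definite matrices Q ∈ ℝ^{3×3} and R ∈ ℝ^{2×2}. For every horizon T > 0 and every ε > 0 there exists x⁰ ∈ ℝ³ with 0 < ‖x⁰‖ ≤ ε such that the zero control u ≡ 0 is the unique optimal control: for every measurable essentially bounded control u: [0,T]→ℝ² and every absolutely continuous trajectory x on [0,T] with x(0) = x⁰ and x'(t) = (u_1(t), x_3(t)u_1(t), u_2(t)) a.e., one has ∫₀^T (x(s)ᵀQx(s) + u(s)ᵀRu(s)) ds ≥ T·(x⁰)ᵀQx⁰, with equality only if u = 0 almost everywhere on [0,T]. -/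

import Mathlib

open MeasureTheory Set Filter Topology

noncomputable def lamD {n : ℕ} (r : Fin n → ℝ) (α : ℝ) (x : Fin n → ℝ) : Fin n → ℝ :=
  fun i => α ^ (r i) * x i

noncomputable def dConst {n : ℕ} (r : Fin n → ℝ) : ℝ := 2 * ∏ i, r i

noncomputable def dilN {n : ℕ} (r : Fin n → ℝ) (x : Fin n → ℝ) : ℝ :=
  (∑ i, |x i| ^ (dConst r / r i)) ^ (dConst r)⁻¹

def IsHom {n m : ℕ} (f : (Fin n → ℝ) → (Fin m → ℝ) → (Fin n → ℝ))
    (r : Fin n → ℝ) (s : Fin m → ℝ) (τ : ℝ) : Prop :=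
  ∀ x u, ∀ α : ℝ, 0 ≤ α →
    f (lamD r α x) (lamD s α u) = fun i => α ^ τ * lamD r α (f x u) i

def IsTraj {n m : ℕ} (f : (Fin n → ℝ) → (Fin m → ℝ) → (Fin n → ℝ))
    (u : ℝ → Fin m → ℝ) (x : ℝ → Fin n → ℝ) (T : ℝ) : Prop :=
  Measurable u ∧
  (∃ C : ℝ, ∀ᵐ t ∂MeasureTheory.volume, t ∈ Set.Icc (0:ℝ) T → ‖u t‖ ≤ C) ∧
  ∀ t ∈ Set.Icc (0:ℝ) T,
    IntervalIntegrable (fun s => f (x s) (u s)) MeasureTheory.volume 0 t ∧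
    x t = x 0 + ∫ s in (0:ℝ)..t, f (x s) (u s)

noncomputable def stageCost {n m : ℕ} (r : Fin n → ℝ) (s : Fin m → ℝ)
    (x : Fin n → ℝ) (u : Fin m → ℝ) : ℝ :=
  ∑ i, |x i| ^ (dConst r / r i) + ∑ j, |u j| ^ (dConst r / s j)

noncomputable def lstar {n m : ℕ} (ℓ : (Fin n → ℝ) → (Fin m → ℝ) → ℝ)
    (x : Fin n → ℝ) : ℝ :=
  ⨅ u : Fin m → ℝ, ℓ x u

noncomputable def Val {n m : ℕ} (f : (Fin n → ℝ) → (Fin m → ℝ) → (Fin n → ℝ))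
    (ℓ : (Fin n → ℝ) → (Fin m → ℝ) → ℝ) (t : ℝ) (x0 : Fin n → ℝ) : ENNReal :=
  sInf { c | ∃ u x, IsTraj f u x t ∧ x 0 = x0 ∧
      c = ∫⁻ s in Set.Ioc (0:ℝ) t, ENNReal.ofReal (ℓ (x s) (u s)) }

def IsKInfty (ρ : ℝ → ℝ) : Prop :=
  Continuous ρ ∧ ρ 0 = 0 ∧ StrictMonoOn ρ (Set.Ici 0) ∧ ∀ c : ℝ, ∃ x ≥ (0:ℝ), c < ρ x

def LocLipOffZero {n m : ℕ} (f : (Fin n → ℝ) → (Fin m → ℝ) → (Fin n → ℝ)) : Prop :=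
  ∀ (u : Fin m → ℝ) (x : Fin n → ℝ), x ≠ 0 →
    ∃ (K : NNReal) (t : Set (Fin n → ℝ)), t ∈ nhds x ∧ LipschitzOnWith K (fun y => f y u) t

def GANC {n m : ℕ} (f : (Fin n → ℝ) → (Fin m → ℝ) → (Fin n → ℝ)) : Prop :=
  ∀ x0 : Fin n → ℝ, ∃ (u : ℝ → Fin m → ℝ) (x : ℝ → Fin n → ℝ),
    (∀ T > (0:ℝ), IsTraj f u x T) ∧ x 0 = x0 ∧
    Filter.Tendsto x Filter.atTop (nhds 0)

noncomputable def lowerDini {n : ℕ} (V : (Fin n → ℝ) → ℝ) (x v : Fin n → ℝ) : ℝ :=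
  Filter.liminf (fun p : ℝ × (Fin n → ℝ) => (V (x + p.1 • p.2) - V x) / p.1)
    ((nhdsWithin 0 (Set.Ioi 0)) ×ˢ nhds v)

open Matrix in
noncomputable def hRobot (x : Fin 3 → ℝ) (u : Fin 2 → ℝ) : Fin 3 → ℝ :=
  ![u 0, x 2 * u 0, u 1]

section Helpers

open Matrix

theorem Matrix.PosDef.exists_mul_sum_sq_le {R : Matrix (Fin 2) (Fin 2) ℝ} (hR : R.PosDef) :
    ∃ lam > (0:ℝ), ∀ v : Fin 2 → ℝ, lam * (v 0 ^ 2 + v 1 ^ 2) ≤ v ⬝ᵥ R.mulVec v := by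
  have hs : R 1 0 = R 0 1 := by simpa using hR.isHermitian.apply 0 1
  have h0 : 0 < R 0 0 := hR.diag_pos
  have h1 : 0 < R 1 1 := hR.diag_pos
  have hd := hR.det_pos
  rw [det_fin_two, hs] at hd
  set p := R 0 0
  set q := R 0 1
  set r := R 1 1
  set lam := (p * r - q * q) / (p + r) with hlam
  have hpr : 0 < p + r := by positivity
  have hl : lam * (p + r) = p * r - q * q := by rw [hlam]; field_simp
  have hpl : 0 < p - lam := by
    have : p - lam = (p ^ 2 + q ^ 2) / (p + r) := by rw [hlam]; field_simp; ring
    rw [this]; positivity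
  refine ⟨lam, div_pos hd hpr, fun v => ?_⟩
  have hv : v ⬝ᵥ R.mulVec v = p * v 0 ^ 2 + 2 * q * v 0 * v 1 + r * v 1 ^ 2 := by
    simp only [dotProduct, mulVec, Fin.sum_univ_two, hs]
    ring
  rw [hv]
  have key : (p - lam) * (p * v 0 ^ 2 + 2 * q * v 0 * v 1 + r * v 1 ^ 2
      - lam * (v 0 ^ 2 + v 1 ^ 2)) = ((p - lam) * v 0 + q * v 1) ^ 2 + lam ^ 2 * v 1 ^ 2 := by
    linear_combination (-v 1 ^ 2) * hl
  refine sub_nonneg.1 (nonneg_of_mul_nonneg_right (a := p - lam) ?_ hpl)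
  rw [key]
  positivity

/-- Points near the origin at which `Q x` annihilates both control directions. -/
theorem exists_mulVec_eq_smul {Q : Matrix (Fin 3) (Fin 3) ℝ} (hQ : Q.PosDef)
    {δ ε : ℝ} (hδ : 0 < δ) (hε : 0 < ε) :
    ∃ (x : Fin 3 → ℝ) (c : ℝ), 0 < c ∧ c < δ ∧ x ≠ 0 ∧ ‖x‖ ≤ ε ∧
      Q.mulVec x = c • ![-x 2, 1, 0] := by
  let a : ℝ → ℝ := fun c => c * Q⁻¹ 2 1 / (1 + c * Q⁻¹ 2 0)
  let X : ℝ → Fin 3 → ℝ := fun c => c • Q⁻¹.mulVec ![-a c, 1, 0]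
  have ha : ContinuousAt a 0 := by
    refine ContinuousAt.div (by fun_prop) (by fun_prop) (by simp)
  have hX : ContinuousAt X 0 := by
    refine continuousAt_id.smul ?_
    have : Continuous fun b : ℝ => Q⁻¹.mulVec ![-b, 1, 0] := by fun_prop
    exact this.continuousAt.comp (f := a) ha
  have e1 : ∀ᶠ c in 𝓝[>] (0:ℝ), ‖X c‖ < ε := by
    refine (hX.norm.eventually_lt continuousAt_const ?_).filter_mono nhdsWithin_le_nhds
    simpa [X] using hε
  have e2 : ∀ᶠ c in 𝓝[>] (0:ℝ), (0:ℝ) < 1 + c * Q⁻¹ 2 0 := by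
    refine (ContinuousAt.eventually_lt (f := fun _ => (0:ℝ)) continuousAt_const
      (g := fun c : ℝ => 1 + c * Q⁻¹ 2 0) (by fun_prop) (by simp)).filter_mono nhdsWithin_le_nhds
  have e3 : ∀ᶠ c in 𝓝[>] (0:ℝ), c ∈ Ioo 0 δ := Ioo_mem_nhdsGT hδ
  obtain ⟨c, h1, h2, h3, h4⟩ := (e1.and (e2.and e3)).exists
  have hX2 : X c 2 = a c := by
    have : X c 2 = c * (-(Q⁻¹ 2 0 * a c) + Q⁻¹ 2 1) := by
      simp [X, mulVec, dotProduct, Fin.sum_univ_three]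
    rw [this]
    simp only [a]
    field_simp
    ring
  have hQX : Q.mulVec (X c) = c • ![-X c 2, 1, 0] := by
    rw [hX2]
    simp only [X]
    rw [mulVec_smul, mulVec_mulVec, mul_nonsing_inv _ hQ.det_pos.ne'.isUnit, one_mulVec]
  refine ⟨X c, c, h3, h4, fun h0 => ?_, h1.le, hQX⟩
  have := congrFun hQX 1
  rw [h0] at this
  simp at this
  exact h3.ne this

theorem intervalIntegrable_comp_of_essBounded {m : ℕ} {u : ℝ → Fin m → ℝ} {T : ℝ} (hT : 0 ≤ T)
    (hu : Measurable u)
    (hb : ∃ C : ℝ, ∀ᵐ t ∂volume, t ∈ Icc (0:ℝ) T → ‖u t‖ ≤ C)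
    {g : (Fin m → ℝ) → ℝ} (hg : Continuous g) :
    IntervalIntegrable (fun s => g (u s)) volume 0 T := by
  obtain ⟨C, hC⟩ := hb
  obtain ⟨K, hK⟩ := (isCompact_closedBall (0 : Fin m → ℝ) C).exists_bound_of_continuousOn
    hg.continuousOn
  rw [intervalIntegrable_iff_integrableOn_Ioc_of_le hT]
  refine Measure.integrableOn_of_bounded (M := K) (by simp)
    (hg.measurable.comp hu).aestronglyMeasurable ?_
  rw [ae_restrict_iff' measurableSet_Ioc]
  filter_upwards [hC] with t ht hm
  exact hK _ (by simpa using ht (Ioc_subset_Icc_self hm))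

theorem sq_integral_le_mul_integral_sq {f : ℝ → ℝ} {T : ℝ} (hT : 0 < T)
    (hf : IntervalIntegrable f volume 0 T)
    (hf2 : IntervalIntegrable (fun s => f s ^ 2) volume 0 T) :
    (∫ s in (0:ℝ)..T, f s) ^ 2 ≤ T * ∫ s in (0:ℝ)..T, f s ^ 2 := by
  set A := ∫ s in (0:ℝ)..T, f s with hA
  have h := intervalIntegral.integral_nonneg (μ := volume) hT.le
    (f := fun s => f s ^ 2 - 2 * (A / T) * f s + (A / T) ^ 2)
    (fun s _ => by nlinarith [sq_nonneg (f s - A / T)])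
  rw [intervalIntegral.integral_add (hf2.sub (hf.const_mul _)) (by simp),
    intervalIntegral.integral_sub hf2 (hf.const_mul _), intervalIntegral.integral_const_mul,
    ← hA, intervalIntegral.integral_const] at h
  have e : T * ((∫ s in (0:ℝ)..T, f s ^ 2) - 2 * (A / T) * A + (T - 0) • (A / T) ^ 2)
      = T * (∫ s in (0:ℝ)..T, f s ^ 2) - A ^ 2 := by
    rw [smul_eq_mul]; field_simp; ring
  nlinarith [mul_nonneg hT.le h]

theorem IsTraj.apply_sub {n m : ℕ} {f : (Fin n → ℝ) → (Fin m → ℝ) → (Fin n → ℝ)}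
    {u : ℝ → Fin m → ℝ} {x : ℝ → Fin n → ℝ} {T : ℝ} (h : IsTraj f u x T)
    {t : ℝ} (ht : t ∈ Icc (0:ℝ) T) (i : Fin n) :
    IntervalIntegrable (fun s => f (x s) (u s) i) volume 0 t ∧
      x t i - x 0 i = ∫ s in (0:ℝ)..t, f (x s) (u s) i := by
  obtain ⟨hi, he⟩ := h.2.2 t ht
  refine ⟨⟨hi.1.eval i, hi.2.eval i⟩, ?_⟩
  have := (ContinuousLinearMap.proj (R := ℝ) (φ := fun _ : Fin n => ℝ)
    i).intervalIntegral_comp_comm hi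
  simp only [ContinuousLinearMap.proj_apply] at this
  rw [this]
  conv_lhs => rw [he]
  simp

theorem IsTraj.continuousOn {n m : ℕ} {f : (Fin n → ℝ) → (Fin m → ℝ) → (Fin n → ℝ)}
    {u : ℝ → Fin m → ℝ} {x : ℝ → Fin n → ℝ} {T : ℝ} (hT : 0 ≤ T) (h : IsTraj f u x T) :
    ContinuousOn x (Icc 0 T) := by
  have hi := (h.2.2 T ⟨hT, le_rfl⟩).1
  have hc := intervalIntegral.continuousOn_primitive_interval' hi left_mem_uIcc
  rw [uIcc_of_le hT] at hc
  exact (continuousOn_const.add hc).congr fun t ht => (h.2.2 t ht).2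

theorem hRobot_displacement_le {u : ℝ → Fin 2 → ℝ} {x : ℝ → Fin 3 → ℝ} {T : ℝ} (hT : 0 < T)
    (h : IsTraj hRobot u x T) {t : ℝ} (ht : t ∈ Icc (0:ℝ) T) :
    |(x t 1 - x 0 1) - x 0 2 * (x t 0 - x 0 0)| ≤
      (∫ s in (0:ℝ)..T, |u s 1|) * ∫ s in (0:ℝ)..T, |u s 0| := by
  have hw : IntervalIntegrable (fun s => |u s 0|) volume 0 T :=
    intervalIntegrable_comp_of_essBounded hT.le h.1 h.2.1 (g := fun v => |v 0|) (by fun_prop)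
  have hv : IntervalIntegrable (fun s => |u s 1|) volume 0 T :=
    intervalIntegrable_comp_of_essBounded hT.le h.1 h.2.1 (g := fun v => |v 1|) (by fun_prop)
  obtain ⟨i0, e0⟩ := h.apply_sub ht 0
  obtain ⟨i1, e1⟩ := h.apply_sub ht 1
  simp only [hRobot, cons_val_zero, cons_val_one] at i0 e0 i1 e1
  have h2 : ∀ s ∈ Icc (0:ℝ) T, |x s 2 - x 0 2| ≤ ∫ s in (0:ℝ)..T, |u s 1| := by
    intro s hs
    obtain ⟨-, e2⟩ := h.apply_sub hs 2
    simp only [hRobot, cons_val_two, tail_cons, head_cons] at e2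
    rw [e2]
    exact (intervalIntegral.abs_integral_le_integral_abs hs.1).trans
      (intervalIntegral.integral_mono_interval le_rfl hs.1 hs.2
        (ae_of_all _ fun s => abs_nonneg _) hv)
  have e : (x t 1 - x 0 1) - x 0 2 * (x t 0 - x 0 0)
      = ∫ s in (0:ℝ)..t, (x s 2 - x 0 2) * u s 0 := by
    rw [e0, e1, ← intervalIntegral.integral_const_mul,
      ← intervalIntegral.integral_sub i1 (i0.const_mul _)]
    simp only [sub_mul]
  set B := ∫ s in (0:ℝ)..T, |u s 1|
  rw [e, ← Real.norm_eq_abs, ← intervalIntegral.integral_const_mul]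
  have hBw : IntervalIntegrable (fun s => B * |u s 0|) volume 0 T := hw.const_mul _
  have hB0 : 0 ≤ B := intervalIntegral.integral_nonneg hT.le fun _ _ => abs_nonneg _
  refine (intervalIntegral.norm_integral_le_of_norm_le ht.1 (g := fun s => B * |u s 0|)
    (ae_of_all _ fun s hs => ?_)
    (hBw.mono_set ?_)).trans
      (intervalIntegral.integral_mono_interval le_rfl ht.1 ht.2
        (ae_of_all _ fun s => mul_nonneg hB0 (abs_nonneg _)) hBw)
  · rw [Real.norm_eq_abs, abs_mul]
    exact mul_le_mul_of_nonneg_right (h2 s ⟨hs.1.le, hs.2.trans ht.2⟩) (abs_nonneg _)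
  · rw [uIcc_of_le ht.1, uIcc_of_le hT.le]
    exact Icc_subset_Icc_right ht.2

theorem Matrix.PosDef.quadratic_tangent_le {Q : Matrix (Fin 3) (Fin 3) ℝ} (hQ : Q.PosDef)
    (x y : Fin 3 → ℝ) :
    x ⬝ᵥ Q.mulVec x + 2 * ((y - x) ⬝ᵥ Q.mulVec x) ≤ y ⬝ᵥ Q.mulVec y := by
  have h := hQ.posSemidef.dotProduct_mulVec_nonneg (y - x)
  rw [star_trivial, mulVec_sub, dotProduct_sub] at h
  have hs : x ⬝ᵥ Q.mulVec (y - x) = (y - x) ⬝ᵥ Q.mulVec x := by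
    have hT : Qᵀ = Q := by simpa using hQ.isHermitian.eq
    rw [dotProduct_mulVec, ← mulVec_transpose, hT, dotProduct_comm]
  have e1 : x ⬝ᵥ Q.mulVec (y - x) = x ⬝ᵥ Q.mulVec y - x ⬝ᵥ Q.mulVec x := by
    rw [mulVec_sub, dotProduct_sub]
  have e2 : (y - x) ⬝ᵥ Q.mulVec y = y ⬝ᵥ Q.mulVec y - x ⬝ᵥ Q.mulVec y := sub_dotProduct ..
  linarith

/-- The cost exceeds that of the zero control by a multiple of the control energy. -/
theorem hRobot_cost_lower_bound {Q : Matrix (Fin 3) (Fin 3) ℝ} (hQ : Q.PosDef)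
    {R : Matrix (Fin 2) (Fin 2) ℝ} {lam c T : ℝ} (hT : 0 < T) (hc : 0 < c)
    (hlam : ∀ v : Fin 2 → ℝ, lam * (v 0 ^ 2 + v 1 ^ 2) ≤ v ⬝ᵥ R.mulVec v)
    {u : ℝ → Fin 2 → ℝ} {x : ℝ → Fin 3 → ℝ} (h : IsTraj hRobot u x T)
    (hx : Q.mulVec (x 0) = c • ![-x 0 2, 1, 0]) :
    T * (x 0 ⬝ᵥ Q.mulVec (x 0)) + (lam - c * T ^ 2) * ∫ s in (0:ℝ)..T, (u s 0 ^ 2 + u s 1 ^ 2) ≤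
      ∫ s in (0:ℝ)..T, (x s ⬝ᵥ Q.mulVec (x s) + u s ⬝ᵥ R.mulVec (u s)) := by
  have hI : ∀ {g : (Fin 2 → ℝ) → ℝ}, Continuous g →
      IntervalIntegrable (fun s => g (u s)) volume 0 T :=
    fun hg => intervalIntegrable_comp_of_essBounded hT.le h.1 h.2.1 hg
  have hsq0 : IntervalIntegrable (fun s => u s 0 ^ 2) volume 0 T :=
    hI (g := fun v => v 0 ^ 2) (by fun_prop)
  have hsq1 : IntervalIntegrable (fun s => u s 1 ^ 2) volume 0 T :=
    hI (g := fun v => v 1 ^ 2) (by fun_prop)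
  have hE : IntervalIntegrable (fun s => u s 0 ^ 2 + u s 1 ^ 2) volume 0 T := hsq0.add hsq1
  set q := x 0 ⬝ᵥ Q.mulVec (x 0)
  set B := ∫ s in (0:ℝ)..T, |u s 1|
  set A := ∫ s in (0:ℝ)..T, |u s 0|
  have hF : IntervalIntegrable
      (fun s => x s ⬝ᵥ Q.mulVec (x s) + u s ⬝ᵥ R.mulVec (u s)) volume 0 T := by
    refine IntervalIntegrable.add (ContinuousOn.intervalIntegrable ?_)
      (hI (g := fun v => v ⬝ᵥ R.mulVec v) (by fun_prop))
    rw [uIcc_of_le hT.le]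
    have hg : Continuous fun y : Fin 3 → ℝ => y ⬝ᵥ Q.mulVec y := by fun_prop
    exact hg.comp_continuousOn (h.continuousOn hT.le)
  have hpt : ∀ s ∈ Icc (0:ℝ) T, (q - 2 * c * (B * A)) + lam * (u s 0 ^ 2 + u s 1 ^ 2) ≤
      x s ⬝ᵥ Q.mulVec (x s) + u s ⬝ᵥ R.mulVec (u s) := by
    intro s hs
    have h1 := hQ.quadratic_tangent_le (x 0) (x s)
    have h2 : (x s - x 0) ⬝ᵥ Q.mulVec (x 0)
        = c * ((x s 1 - x 0 1) - x 0 2 * (x s 0 - x 0 0)) := by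
      rw [hx]
      simp [dotProduct, Fin.sum_univ_three]
      ring
    have h3 := (abs_le.1 (hRobot_displacement_le hT h hs)).1
    have h4 := mul_le_mul_of_nonneg_left h3 hc.le
    have h5 := hlam (u s)
    rw [h2] at h1
    linarith
  have hmono := intervalIntegral.integral_mono_on hT.le
    ((intervalIntegrable_const (c := q - 2 * c * (B * A))).add (hE.const_mul lam)) hF hpt
  rw [intervalIntegral.integral_add (by simp) (hE.const_mul lam),
    intervalIntegral.integral_const_mul, intervalIntegral.integral_const, smul_eq_mul,
    sub_zero] at hmono
  have hA2 : A ^ 2 ≤ T * ∫ s in (0:ℝ)..T, u s 0 ^ 2 := by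
    simpa only [sq_abs] using sq_integral_le_mul_integral_sq (f := fun s => |u s 0|) hT
      (hI (g := fun v => |v 0|) (by fun_prop)) (by simpa only [sq_abs] using hsq0)
  have hB2 : B ^ 2 ≤ T * ∫ s in (0:ℝ)..T, u s 1 ^ 2 := by
    simpa only [sq_abs] using sq_integral_le_mul_integral_sq (f := fun s => |u s 1|) hT
      (hI (g := fun v => |v 1|) (by fun_prop)) (by simpa only [sq_abs] using hsq1)
  have hsplit := intervalIntegral.integral_add hsq0 hsq1
  have hAB : 2 * (B * A) ≤ T * ∫ s in (0:ℝ)..T, (u s 0 ^ 2 + u s 1 ^ 2) := by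
    rw [hsplit]
    nlinarith [sq_nonneg (B - A)]
  have := mul_le_mul_of_nonneg_left hAB (mul_pos hc hT).le
  linarith

end Helpers

open Matrix in
/-- with quadratic stage cost, arbitrarily close to the origin there are
initial values for which the zero control is the unique optimal control. -/
theorem stmt5 (Q : Matrix (Fin 3) (Fin 3) ℝ) (hQ : Q.PosDef)
    (R : Matrix (Fin 2) (Fin 2) ℝ) (hR : R.PosDef) :
    ∀ T > (0:ℝ), ∀ ε > (0:ℝ), ∃ x0 : Fin 3 → ℝ, x0 ≠ 0 ∧ ‖x0‖ ≤ ε ∧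
      ∀ (u : ℝ → Fin 2 → ℝ) (x : ℝ → Fin 3 → ℝ),
        IsTraj hRobot u x T → x 0 = x0 →
        (T * (x0 ⬝ᵥ Q.mulVec x0) ≤
            ∫ s in (0:ℝ)..T, (x s ⬝ᵥ Q.mulVec (x s) + u s ⬝ᵥ R.mulVec (u s))) ∧
        ((∫ s in (0:ℝ)..T, (x s ⬝ᵥ Q.mulVec (x s) + u s ⬝ᵥ R.mulVec (u s)))
            = T * (x0 ⬝ᵥ Q.mulVec x0) →
          ∀ᵐ s ∂MeasureTheory.volume, s ∈ Set.Icc (0:ℝ) T → u s = 0) := by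
  intro T hT ε hε
  obtain ⟨lam, hlam0, hlam⟩ := hR.exists_mul_sum_sq_le
  obtain ⟨x0, c, hc, hcT, hne, hnorm, hQx⟩ :=
    exists_mulVec_eq_smul hQ (div_pos hlam0 (pow_pos hT 2)) hε
  rw [lt_div_iff₀ (pow_pos hT 2)] at hcT
  refine ⟨x0, hne, hnorm, ?_⟩
  rintro u x h rfl
  have hbound := hRobot_cost_lower_bound hQ hT hc hlam h hQx
  set E := ∫ s in (0:ℝ)..T, (u s 0 ^ 2 + u s 1 ^ 2) with hE
  have hE0 : 0 ≤ E := intervalIntegral.integral_nonneg hT.le fun _ _ => by positivity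
  have hgap : 0 < lam - c * T ^ 2 := sub_pos.2 hcT
  refine ⟨by nlinarith [mul_nonneg hgap.le hE0], fun heq => ?_⟩
  have hEz : E = 0 := by
    by_contra hne
    have := mul_pos hgap (lt_of_le_of_ne hE0 (Ne.symm hne))
    linarith
  have hsum : IntervalIntegrable (fun s => u s 0 ^ 2 + u s 1 ^ 2) volume 0 T :=
    intervalIntegrable_comp_of_essBounded hT.le h.1 h.2.1
      (g := fun v => v 0 ^ 2 + v 1 ^ 2) (by fun_prop)
  rw [hE, intervalIntegral.integral_of_le hT.le,
    setIntegral_eq_zero_iff_of_nonneg_ae (ae_of_all _ fun s => by positivity) hsum.1,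
    restrict_Ioc_eq_restrict_Icc, Filter.EventuallyEq, ae_restrict_iff' measurableSet_Icc] at hEz
  filter_upwards [hEz] with s hs hm
  have hz : u s 0 ^ 2 + u s 1 ^ 2 = 0 := hs hm
  have h0 : u s 0 = 0 := sq_eq_zero_iff.1 (by linarith [sq_nonneg (u s 0), sq_nonneg (u s 1)])
  have h1 : u s 1 = 0 := sq_eq_zero_iff.1 (by linarith [sq_nonneg (u s 0), sq_nonneg (u s 1)])
  ext i
  fin_cases i
  · exact h0
  · exact h1
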